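/- arXiv:2503.22110 — 2 statements merged into one kernel-verified Lean document; each statement's English description precedes it below -/
import Mathlib

section
/- There exists a finite bounded graded poset that is CC-shellable but not CL-shellable. -/
open scoped Classical

variable {P : Type*} [PartialOrder P] [BoundedOrder P]

/-- `CoverList l` : consecutive entries of `l` are cover relations. -/
def CoverList : List P → Prop
  | x :: y :: t => x ⋖ y ∧ CoverList (y :: t)
  | _ => True

/-- `SatFromTo l x y` : `l` is a saturated chain (i.e. a maximal chain of the interval
`[x,y]`) starting at `x` and ending at `y`. -/
def SatFromTo (l : List P) (x y : P) : Prop :=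
  l ≠ [] ∧ l.head? = some x ∧ l.getLast? = some y ∧ CoverList l

/-- `m` is a maximal chain of the bounded poset `P`. -/
def MaxChainOfP (m : List P) : Prop := SatFromTo m ⊥ ⊤

/-- `r` is a root of `x`, i.e. a maximal chain of `[⊥, x]` (it contains `x`). -/
def RootOf (r : List P) (x : P) : Prop := SatFromTo r ⊥ x

/-- The label sequence of a chain (the second argument, which starts at the last
element of the root `r`) with respect to a chain-edge labeling `lab`. -/
def labelSeq {Λ : Type*} (lab : List P → P → P → Λ) : List P → List P → List Λ
  | r, x :: y :: t => lab r x y :: labelSeq lab (r ++ [y]) (y :: t)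
  | _, _ => []

/-- The pair of rooted cover relations `[u,v]_r`, `[v,w]_{r∪{v}}` is a topological
ascent: its label sequence lexicographically strictly precedes the label sequence of
every other maximal chain of `[u,w]_r`. -/
def TopAscent (lab : List P → P → P → ℤ) (r : List P) (u v w : P) : Prop :=
  ∀ c : List P, SatFromTo c u w → c ≠ [u, v, w] →
    List.Lex (· < ·) (labelSeq lab r [u, v, w]) (labelSeq lab r c)

/-- The chain (second argument) with root `r` is topologically ascending. -/
def TopAscending (lab : List P → P → P → ℤ) : List P → List P → Prop
  | r, u :: v :: w :: t => TopAscent lab r u v w ∧ TopAscending lab (r ++ [v]) (v :: w :: t)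
  | _, _ => True

/-- TCL-labeling : every rooted interval has a unique topologically ascending
maximal chain. -/
def IsTCLLabeling (lab : List P → P → P → ℤ) : Prop :=
  ∀ x y : P, x ≤ y → ∀ r : List P, RootOf r x →
    ∃! c : List P, SatFromTo c x y ∧ TopAscending lab r c

/-- CC-labeling : a TCL-labeling such that in every rooted interval distinct maximal
chains get distinct label sequences, none of which is a prefix of another. -/
def IsCCLabeling (lab : List P → P → P → ℤ) : Prop :=
  IsTCLLabeling lab ∧
    ∀ x y : P, x ≤ y → ∀ r : List P, RootOf r x →
      ∀ c c' : List P, SatFromTo c x y → SatFromTo c' x y → c ≠ c' →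
        ¬ labelSeq lab r c <+: labelSeq lab r c'

/-- CL-labeling with labels in an arbitrary poset `Λ`. -/
def IsCLLabeling {Λ : Type*} [PartialOrder Λ] (lab : List P → P → P → Λ) : Prop :=
  ∀ x y : P, x ≤ y → ∀ r : List P, RootOf r x →
    ∃ c : List P, (SatFromTo c x y ∧ List.Chain' (· < ·) (labelSeq lab r c)) ∧
      (∀ c' : List P, SatFromTo c' x y → List.Chain' (· < ·) (labelSeq lab r c') → c' = c) ∧
      (∀ c' : List P, SatFromTo c' x y → c' ≠ c →
        List.Lex (· < ·) (labelSeq lab r c) (labelSeq lab r c'))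

def TCLShellable (P : Type*) [PartialOrder P] [BoundedOrder P] : Prop :=
  ∃ lab : List P → P → P → ℤ, IsTCLLabeling lab

def CCShellable (P : Type*) [PartialOrder P] [BoundedOrder P] : Prop :=
  ∃ lab : List P → P → P → ℤ, IsCCLabeling lab

def CLShellable (P : Type*) [PartialOrder P] [BoundedOrder P] : Prop :=
  ∃ (Λ : Type) (_ : PartialOrder Λ) (lab : List P → P → P → Λ), IsCLLabeling lab

/-- `P` is graded : all maximal chains of `P` have the same length. -/
def Graded (P : Type*) [PartialOrder P] [BoundedOrder P] : Prop :=
  ∀ c c' : List P, MaxChainOfP c → MaxChainOfP c' → c.length = c'.length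

/-- `Γ` is a total order `m₁, …, m_t` on the maximal chains of `P`. -/
def Enumerates (Γ : List (List P)) : Prop :=
  Γ.Nodup ∧ ∀ m : List P, m ∈ Γ ↔ MaxChainOfP m

/-- `Γ` is a total order on the maximal chains which agrees with (is consistent with)
the lexicographic order on maximal chains induced by `lab`. -/
def AgreesWithLex (lab : List P → P → P → ℤ) (Γ : List (List P)) : Prop :=
  Enumerates Γ ∧ ∀ i j : ℕ, i < j → j < Γ.length →
    ¬ List.Lex (· < ·) (labelSeq lab [(⊥ : P)] (Γ.getD j []))
        (labelSeq lab [(⊥ : P)] (Γ.getD i []))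

/-- Position in `Γ` of the earliest maximal chain containing all elements of `l`. -/
noncomputable def fidx (Γ : List (List P)) (l : List P) : ℕ :=
  Γ.findIdx fun m => decide (∀ a ∈ l, a ∈ m)

/-- `a'` witnesses that the earliest chain containing `r ∪ {a}` is "sandwiched" by
two chains containing `r ∪ {a'}`. -/
def Sandwiched (Γ : List (List P)) (r : List P) (x a a' : P) : Prop :=
  x ⋖ a' ∧ fidx Γ (r ++ [a']) < fidx Γ (r ++ [a]) ∧
    ∃ l : ℕ, fidx Γ (r ++ [a]) < l ∧ l < Γ.length ∧ ∀ w ∈ r ++ [a'], w ∈ Γ.getD l []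

/-- The label (a position in `Γ`) that the CE-labeling determined by the total order
`Γ` assigns to the rooted cover relation `[x,a]_r`. -/
noncomputable def detLabel (Γ : List (List P)) (r : List P) (x a : P) : ℕ :=
  if h : ∃ n : ℕ, ∃ a' : P, Sandwiched Γ r x a a' ∧ fidx Γ (r ++ [a']) = n then
    detLabel Γ r x (Nat.find_spec h).choose
  else fidx Γ (r ++ [a])
termination_by fidx Γ (r ++ [a])
decreasing_by exact ((Nat.find_spec h).choose_spec).1.2.1

/-- The CE-labeling of `P` determined by the total order `Γ` on maximal chains. -/
noncomputable def detLabeling (Γ : List (List P)) : List P → P → P → ℤ :=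
  fun r x a => (detLabel Γ r x a : ℤ)

/-- `Ω` is a recursive first atom set (RFAS) for `P`. -/
def IsRFAS (Ω : List P → P → P → P) : Prop :=
  (∀ c : List P, CoverList c → c.length ≤ 2) ∨
    ∀ x y : P, x < y → ∀ r : List P, RootOf r x →
      (x ⋖ Ω r x y ∧ Ω r x y ≤ y) ∧
      ∀ a : P, x ⋖ a → a < y →
        (a = Ω r x y ↔ a = Ω r x (Ω (r ++ [a]) a y)) ∧
        (a ≠ Ω r x y →
          ∃ (p : ℕ) (A B : ℕ → P), 1 ≤ p ∧
            (∀ i, 1 ≤ i → i ≤ p → x ⋖ A i ∧ A i ≤ y) ∧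
            A p = Ω r x (Ω (r ++ [a]) a y) ∧ A 1 = Ω r x y ∧
            ∀ i, 1 ≤ i → i ≤ p - 1 →
              B i = Ω (r ++ [A (i + 1)]) (A (i + 1)) y ∧ A i = Ω r x (B i))

/-- The chain (second argument, a saturated chain from the last element of the root to
`y`) is the first atom chain `c(r, x, y)` of the rooted interval with top `y`:
each step except possibly the last follows the first atoms of `Ω`. -/
def IsFAC (Ω : List P → P → P → P) (y : P) : List P → List P → Prop
  | r, x :: z :: t => (t ≠ [] → z = Ω r x y) ∧ IsFAC Ω y (r ++ [z]) (z :: t)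
  | _, _ => True

/-- The chain (second argument) with root `r` contains a pseudo descent with respect
to `Ω`. -/
def HasPseudoDescent (Ω : List P → P → P → P) : List P → List P → Prop
  | r, u :: v :: w :: t => v ≠ Ω r u w ∨ HasPseudoDescent Ω (r ++ [v]) (v :: w :: t)
  | _, _ => False

/-- `m → m'` : `m` is obtained from the maximal chain `m'` by replacing a pseudo
descent `x ⋖ y ⋖ z` of `m'` with the first atom chain `c(m^x, x, z)`. -/
def StepRel (Ω : List P → P → P → P) (m m' : List P) : Prop :=
  MaxChainOfP m ∧ MaxChainOfP m' ∧
    ∃ (x y z : P) (r d c : List P),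
      RootOf r x ∧ x ⋖ y ∧ y ⋖ z ∧ y ≠ Ω r x z ∧
      m' = r ++ y :: z :: d ∧
      SatFromTo c x z ∧ IsFAC Ω z r c ∧
      m = r ++ c.tail ++ d

/-- `Γ` is a linear extension of the partial order `⪯` (the reflexive-transitive
closure of `→`) on the maximal chains of `P`. -/
def LinExtOf (Ω : List P → P → P → P) (Γ : List (List P)) : Prop :=
  Enumerates Γ ∧ ∀ i j : ℕ, i < Γ.length → j < Γ.length →
    Relation.ReflTransGen (StepRel Ω) (Γ.getD i []) (Γ.getD j []) → i ≤ j

/-- `Γ`, a total order on the facets (maximal chains) of the order complex `Δ(P)`,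
is a shelling order: for each `j` the intersection of the `j`-th facet with the union
of the earlier ones is pure of dimension one less than that of the `j`-th facet. -/
def IsShelling (Γ : List (List P)) : Prop :=
  ∀ j : ℕ, 0 < j → j < Γ.length → ∀ S : Finset P,
    S ⊆ (Γ.getD j []).toFinset → (∃ i < j, S ⊆ (Γ.getD i []).toFinset) →
    ∃ T : Finset P, S ⊆ T ∧ T ⊆ (Γ.getD j []).toFinset ∧
      (∃ i < j, T ⊆ (Γ.getD i []).toFinset) ∧
      T.card + 1 = (Γ.getD j []).toFinset.card

/-- Condition (LC) for a linear extension `Γ` of `⪯`. -/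
def LCCondition (Γ : List (List P)) : Prop :=
  ∀ i j k : ℕ, i < j → j < k → k < Γ.length →
    ∀ (r : List P) (x y y' z : P), RootOf r x → x ⋖ y → y ⋖ z → x ⋖ y' →
      (∀ w ∈ r ++ [y, z], w ∈ Γ.getD i []) →
      (∀ w ∈ r ++ [y, z], w ∈ Γ.getD k []) →
      (∀ w ∈ r ++ [y'], w ∈ Γ.getD j []) → y' = y

/-- `Ω` is a labeling-compatible recursive first atom set (LCRFAS). -/
def IsLCRFAS (Ω : List P → P → P → P) : Prop :=
  IsRFAS Ω ∧ ∃ Γ : List (List P), LinExtOf Ω Γ ∧ LCCondition Γ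

/-- The CE-labeling `lab` is compatible with the RFAS `Ω` : in every rooted interval
the first atom lies on a lexicographically smallest maximal chain. -/
def Compatible (lab : List P → P → P → ℤ) (Ω : List P → P → P → P) : Prop :=
  ∀ x y : P, x < y → ∀ r : List P, RootOf r x →
    ∃ c : List P, SatFromTo c x y ∧ Ω r x y ∈ c ∧
      ∀ c' : List P, SatFromTo c' x y →
        ¬ List.Lex (· < ·) (labelSeq lab r c') (labelSeq lab r c)

namespace CCNotCL

/-- The underlying set of a 14-element poset of rank 4: the bottom is `0`, the atoms are `1, 2, 3`,
the elements of rank two are `4, …, 8`, the coatoms are `9, …, 12` and the top is `13`. -/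
def Q : Type := Fin 14

instance : DecidableEq Q := inferInstanceAs (DecidableEq (Fin 14))
instance : Fintype Q := inferInstanceAs (Fintype (Fin 14))
instance (n : ℕ) : OfNat Q n := inferInstanceAs (OfNat (Fin 14) n)

/-- The list of upper covers. -/
def upperCovers (x : Q) : List Q :=
  ([[1, 2, 3], [4, 5, 6], [4, 5, 8], [6, 7, 8], [10, 11], [9, 12], [9, 10, 11], [9],
    [9, 10, 12], [13], [13], [13], [13], []] : List (List Q)).getD (Fin.val x) []

/-- The list of elements strictly above. -/
def strictlyAbove (x : Q) : List Q :=
  ([[1, 2, 3, 4, 5, 6, 7, 8, 9, 10, 11, 12, 13], [4, 5, 6, 9, 10, 11, 12, 13],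
    [4, 5, 8, 9, 10, 11, 12, 13], [6, 7, 8, 9, 10, 11, 12, 13], [10, 11, 13], [9, 12, 13],
    [9, 10, 11, 13], [9, 13], [9, 10, 12, 13], [13], [13], [13], [13], []] :
    List (List Q)).getD (Fin.val x) []

def rank (x : Q) : ℕ :=
  [0, 1, 1, 1, 2, 2, 2, 2, 2, 3, 3, 3, 3, 4].getD (Fin.val x) 0

instance : LE Q := ⟨fun x y => x = y ∨ y ∈ strictlyAbove x⟩
instance : LT Q := ⟨fun x y => y ∈ strictlyAbove x⟩
instance : DecidableLE Q := fun x y => inferInstanceAs (Decidable (x = y ∨ y ∈ strictlyAbove x))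
instance : DecidableLT Q := fun x y => inferInstanceAs (Decidable (y ∈ strictlyAbove x))

instance : PartialOrder Q where
  le_refl x := Or.inl rfl
  le_trans := by decide +kernel
  lt_iff_le_not_ge := by decide +kernel
  le_antisymm := by decide +kernel

instance : BoundedOrder Q where
  top := 13
  bot := 0
  le_top := by decide +kernel
  bot_le := by decide +kernel

theorem covBy_iff : ∀ x y : Q, x ⋖ y ↔ y ∈ upperCovers x := by
  unfold CovBy
  decide +kernel

theorem rank_of_mem_upperCovers : ∀ x y : Q, y ∈ upperCovers x → rank y = rank x + 1 := by
  decide +kernel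

/-- The saturated chains of length `n` from `x` to `y`. -/
def chainsOfLength : ℕ → Q → Q → List (List Q)
  | 0, x, y => if x = y then [[x]] else []
  | n + 1, x, y => (upperCovers x).flatMap fun z => (chainsOfLength n z y).map (x :: ·)

/-- The maximal chains of the interval `[x, y]`. -/
def chains (x y : Q) : List (List Q) := chainsOfLength (rank y - rank x) x y

theorem satFromTo_cons_cons {x z y w : Q} {t : List Q} :
    SatFromTo (w :: z :: t) x y ↔ w = x ∧ z ∈ upperCovers x ∧ SatFromTo (z :: t) z y := by
  simp only [SatFromTo, CoverList, covBy_iff]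
  constructor
  · rintro ⟨-, h, h', hz, ht⟩
    obtain rfl : w = x := by simpa using h
    exact ⟨rfl, hz, by simp, by simp, by simpa using h', ht⟩
  · rintro ⟨rfl, h, -, -, h', ht⟩
    exact ⟨by simp, by simp, by simpa using h', h, ht⟩

theorem satFromTo_singleton {x y w : Q} : SatFromTo [w] x y ↔ w = x ∧ w = y := by
  simp [SatFromTo, CoverList]

theorem not_satFromTo_nil {x y : Q} : ¬ SatFromTo [] x y := by
  simp [SatFromTo]

theorem length_add_rank {l : List Q} {x y : Q} (h : SatFromTo l x y) :
    l.length + rank x = rank y + 1 := by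
  induction l generalizing x with
  | nil => exact absurd h not_satFromTo_nil
  | cons w t ih =>
    cases t with
    | nil =>
      obtain ⟨rfl, rfl⟩ := satFromTo_singleton.1 h
      simp [add_comm]
    | cons z t =>
      obtain ⟨-, hz, h⟩ := satFromTo_cons_cons.1 h
      have h1 := ih h
      have h2 := rank_of_mem_upperCovers _ _ hz
      simp only [List.length_cons] at h1 ⊢
      omega

theorem mem_chainsOfLength {n : ℕ} {l : List Q} {x y : Q} :
    l ∈ chainsOfLength n x y ↔ SatFromTo l x y ∧ l.length = n + 1 := by
  induction n generalizing l x with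
  | zero =>
    rcases l with _ | ⟨w, _ | ⟨z, t⟩⟩
    · by_cases hxy : x = y <;> simp [chainsOfLength, hxy]
    · by_cases hxy : x = y
      · subst hxy
        simp [chainsOfLength, satFromTo_singleton]
      · simp only [chainsOfLength, hxy, if_false, satFromTo_singleton, List.not_mem_nil, false_iff]
        rintro ⟨⟨rfl, rfl⟩, -⟩
        exact hxy rfl
    · by_cases hxy : x = y <;> simp [chainsOfLength, hxy]
  | succ n ih =>
    simp only [chainsOfLength, List.mem_flatMap, List.mem_map]
    constructor
    · rintro ⟨z, hz, t, ht, rfl⟩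
      obtain ⟨ht, hn⟩ := ih.1 ht
      rcases t with _ | ⟨z', t⟩
      · exact absurd ht not_satFromTo_nil
      · obtain rfl : z' = z := by simpa using ht.2.1
        exact ⟨satFromTo_cons_cons.2 ⟨rfl, hz, ht⟩, by simpa using hn⟩
    · rintro ⟨h, hn⟩
      rcases l with _ | ⟨w, _ | ⟨z, t⟩⟩
      · simp at hn
      · simp at hn
      · obtain ⟨rfl, hz, h⟩ := satFromTo_cons_cons.1 h
        exact ⟨z, hz, z :: t, ih.2 ⟨h, by simpa using hn⟩, rfl⟩

theorem satFromTo_iff {l : List Q} {x y : Q} : SatFromTo l x y ↔ l ∈ chains x y := by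
  rw [chains, mem_chainsOfLength]
  refine ⟨fun h => ⟨h, ?_⟩, fun h => h.1⟩
  have h1 := length_add_rank h
  have h2 : 0 < l.length := List.length_pos_iff.2 h.1
  omega

theorem graded : Graded Q := by
  intro c c' h h'
  have h1 := length_add_rank h
  have h2 := length_add_rank h'
  omega

/-! ### A CC-labeling -/

/-- A CC-labeling not depending on the root. All edges out of the bottom have the same label. -/
def edgeLabel (x y : Q) : ℤ :=
  match rank x with
  | 1 => (([[8, 7, 5], [9, 6, 2], [4, 3, 1]] : List (List ℤ)).getD (Fin.val x - 1) []).getD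
      ((upperCovers x).idxOf y) 0
  | 2 => (Fin.val y : ℤ)
  | _ => 0

def edgeLabels : List Q → List ℤ
  | x :: y :: t => edgeLabel x y :: edgeLabels (y :: t)
  | _ => []

theorem labelSeq_edgeLabel (r c : List Q) :
    labelSeq (fun _ => edgeLabel) r c = edgeLabels c := by
  induction c generalizing r with
  | nil => rfl
  | cons x t ih =>
    cases t with
    | nil => rfl
    | cons y t => simp only [labelSeq, edgeLabels, ih]

/-- Topological ascents of `edgeLabel`. -/
def Ascent (u v w : Q) : Prop :=
  ∀ c ∈ chains u w, c ≠ [u, v, w] → edgeLabels [u, v, w] < edgeLabels c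

instance (u v w : Q) : Decidable (Ascent u v w) := by
  unfold Ascent
  infer_instance

def ascending : List Q → Bool
  | u :: v :: w :: t => decide (Ascent u v w) && ascending (v :: w :: t)
  | _ => true

theorem topAscent_iff (r : List Q) (u v w : Q) :
    TopAscent (fun _ => edgeLabel) r u v w ↔ Ascent u v w := by
  simp only [TopAscent, Ascent, satFromTo_iff, labelSeq_edgeLabel]
  rfl

theorem topAscending_iff (r c : List Q) :
    TopAscending (fun _ => edgeLabel) r c ↔ ascending c = true := by
  induction c generalizing r with
  | nil => simp [TopAscending, ascending]
  | cons u t ih =>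
    rcases t with _ | ⟨v, _ | ⟨w, t⟩⟩
    · simp [TopAscending, ascending]
    · simp [TopAscending, ascending]
    · simp [TopAscending, ascending, topAscent_iff, ih]

theorem exists_unique_ascending : ∀ x y : Q, x ≤ y →
    ∃ c ∈ chains x y, ascending c = true ∧ ∀ c' ∈ chains x y, ascending c' = true → c' = c := by
  decide +kernel

theorem edgeLabels_prefix_free : ∀ x y : Q, ∀ c ∈ chains x y, ∀ c' ∈ chains x y, c ≠ c' →
    ¬ edgeLabels c <+: edgeLabels c' := by
  decide +kernel

theorem ccShellable : CCShellable Q := by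
  refine ⟨fun _ => edgeLabel, fun x y hxy r _ => ?_, fun x y _ r _ c c' hc hc' hne => ?_⟩
  · obtain ⟨c, hc, hasc, huniq⟩ := exists_unique_ascending x y hxy
    exact ⟨c, ⟨satFromTo_iff.2 hc, (topAscending_iff r c).2 hasc⟩, fun c' h =>
      huniq c' (satFromTo_iff.1 h.1) ((topAscending_iff r c').1 h.2)⟩
  · rw [labelSeq_edgeLabel, labelSeq_edgeLabel]
    exact edgeLabels_prefix_free x y c (satFromTo_iff.1 hc) c' (satFromTo_iff.1 hc') hne

/-! ### There is no CL-labeling -/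

section CL

variable {Λ : Type} [PartialOrder Λ] {lab : List Q → Q → Q → Λ}

theorem lt_or_eq_of_lex_cons {a b : Λ} {l l' : List Λ}
    (h : List.Lex (· < ·) (a :: l) (b :: l')) : a < b ∨ a = b ∧ List.Lex (· < ·) l l' := by
  cases h with
  | rel h => exact Or.inl h
  | cons h => exact Or.inr ⟨rfl, h⟩

/-- The chain `c` with root `r` is increasing. -/
def Increasing (lab : List Q → Q → Q → Λ) (r c : List Q) : Prop :=
  List.IsChain (· < ·) (labelSeq lab r c)

theorem exists_increasing (h : IsCLLabeling lab) (r : List Q) (x y : Q) (hxy : x ≤ y)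
    (hr : r ∈ chains 0 x) : ∃ c ∈ chains x y, Increasing lab r c := by
  obtain ⟨c, ⟨hc, hi⟩, -⟩ := h x y hxy r (satFromTo_iff.2 hr)
  exact ⟨c, satFromTo_iff.1 hc, hi⟩

theorem increasing_unique (h : IsCLLabeling lab) {r : List Q} {x y : Q} (hxy : x ≤ y)
    (hr : r ∈ chains 0 x) {c c' : List Q} (hc : c ∈ chains x y) (hc' : c' ∈ chains x y)
    (hi : Increasing lab r c) (hi' : Increasing lab r c') : c = c' := by
  obtain ⟨d, -, hd, -⟩ := h x y hxy r (satFromTo_iff.2 hr)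
  rw [hd c (satFromTo_iff.2 hc) hi, hd c' (satFromTo_iff.2 hc') hi']

theorem increasing_lex (h : IsCLLabeling lab) {r : List Q} {x y : Q} (hxy : x ≤ y)
    (hr : r ∈ chains 0 x) {c c' : List Q} (hc : c ∈ chains x y) (hc' : c' ∈ chains x y)
    (hi : Increasing lab r c) (hne : c' ≠ c) :
    List.Lex (· < ·) (labelSeq lab r c) (labelSeq lab r c') := by
  obtain ⟨d, -, hd, hlex⟩ := h x y hxy r (satFromTo_iff.2 hr)
  obtain rfl := hd c (satFromTo_iff.2 hc) hi
  exact hlex c' (satFromTo_iff.2 hc') hne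

theorem increasing_cons {r t : List Q} {x q z : Q} :
    Increasing lab r (x :: q :: z :: t) ↔
      lab r x q < lab (r ++ [q]) q z ∧ Increasing lab (r ++ [q]) (q :: z :: t) := by
  simp [Increasing, labelSeq]

theorem increasing_pair {r : List Q} {x q : Q} : Increasing lab r [x, q] := by
  simp [Increasing, labelSeq]

/-- If the label of `p` is below the label of `q` and `p < w`, then no increasing maximal chain
of `[0, w]` passes through `q`. -/
theorem not_increasing_of_lt (h : IsCLLabeling lab) {p q w : Q} {t t' : List Q}
    (hlt : lab [0] 0 p < lab [0] 0 q) (hp : 0 :: p :: t' ∈ chains 0 w)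
    (hq : 0 :: q :: t ∈ chains 0 w) : ¬ Increasing lab [0] (0 :: q :: t) := by
  intro hi
  have hne : 0 :: p :: t' ≠ 0 :: q :: t := by
    intro he
    simp only [List.cons.injEq] at he
    exact hlt.ne (by rw [he.2.1])
  have hl := increasing_lex h (bot_le : (⊥ : Q) ≤ w) (by decide) hq hp hi hne
  simp only [labelSeq] at hl
  rcases lt_or_eq_of_lex_cons hl with h1 | ⟨h1, -⟩
  · exact lt_asymm hlt h1
  · exact hlt.ne h1.symm

/-- If the label of `p` is below the label of `q` and `p < w`, then an increasing maximal chain of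
`[q, w]` cannot begin with an ascent from `0`. -/
theorem not_increasing_tail_of_lt (h : IsCLLabeling lab) {p q z w : Q} {t t' : List Q}
    (hlt : lab [0] 0 p < lab [0] 0 q) (hp : 0 :: p :: t' ∈ chains 0 w)
    (hq : 0 :: q :: z :: t ∈ chains 0 w) (hz : lab [0] 0 q < lab [0, q] q z) :
    ¬ Increasing lab [0, q] (q :: z :: t) := fun hi =>
  not_increasing_of_lt h hlt hp hq (increasing_cons.2 ⟨hz, hi⟩)

theorem label_lt_of_lt (h : IsCLLabeling lab) {a b z : Q} (hab : lab [0] 0 a < lab [0] 0 b)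
    (ha : [0, a, z] ∈ chains 0 z) (hb : [0, b, z] ∈ chains 0 z)
    (hz : ∀ c ∈ chains 0 z, c = [0, a, z] ∨ c = [0, b, z]) :
    lab [0] 0 a < lab [0, a] a z := by
  obtain ⟨c, hc, hi⟩ := exists_increasing h [0] 0 z (bot_le : (⊥ : Q) ≤ z) (by decide)
  rcases hz c hc with rfl | rfl
  · exact (increasing_cons.1 hi).1
  · exact absurd hi (not_increasing_of_lt h hab ha hb)

theorem label_lt_of_increasing (h : IsCLLabeling lab) {a b z : Q} (hne : a ≠ b)
    (ha : [0, a, z] ∈ chains 0 z) (hb : [0, b, z] ∈ chains 0 z)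
    (hi : Increasing lab [0] [0, a, z]) : lab [0] 0 a < lab [0] 0 b := by
  have hl := increasing_lex h (bot_le : (⊥ : Q) ≤ z) (by decide) ha hb hi
    (by simpa using hne.symm)
  simp only [labelSeq] at hl
  rcases lt_or_eq_of_lex_cons hl with h1 | ⟨h1, h2⟩
  · exact h1
  · rcases lt_or_eq_of_lex_cons h2 with h3 | ⟨-, h4⟩
    · have hi' : Increasing lab [0] [0, b, z] :=
        increasing_cons.2 ⟨h1 ▸ (increasing_cons.1 hi).1.trans h3, increasing_pair⟩
      have := increasing_unique h (bot_le : (⊥ : Q) ≤ z) (by decide) ha hb hi hi'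
      exact absurd (by simpa using this) hne
    · cases h4

theorem label_lt_or_lt (h : IsCLLabeling lab) {a b z : Q} (hne : a ≠ b)
    (ha : [0, a, z] ∈ chains 0 z) (hb : [0, b, z] ∈ chains 0 z)
    (hz : ∀ c ∈ chains 0 z, c = [0, a, z] ∨ c = [0, b, z]) :
    lab [0] 0 a < lab [0] 0 b ∨ lab [0] 0 b < lab [0] 0 a := by
  obtain ⟨c, hc, hi⟩ := exists_increasing h [0] 0 z (bot_le : (⊥ : Q) ≤ z) (by decide)
  rcases hz c hc with rfl | rfl
  · exact Or.inl (label_lt_of_increasing h hne ha hb hi)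
  · exact Or.inr (label_lt_of_increasing h hne.symm hb ha hi)

/-- If `y` is a common upper bound of `p` and `q`, and the only maximal chain of `[q, y]` passes
through an element whose lower covers are `q` and `s`, then the labels of `p`, `q`, `s` cannot
increase in this order. -/
theorem false_of_unique_chain (h : IsCLLabeling lab) {p q s : Q} (z y : Q) (t : List Q)
    (hpq : lab [0] 0 p < lab [0] 0 q) (hqs : lab [0] 0 q < lab [0] 0 s)
    (hq : [0, q, z] ∈ chains 0 z) (hs : [0, s, z] ∈ chains 0 z)
    (hz : ∀ c ∈ chains 0 z, c = [0, q, z] ∨ c = [0, s, z]) (hqy : q ≤ y)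
    (hr : [0, q] ∈ chains 0 q) (hy : ∀ c ∈ chains q y, c = [q, z, y])
    (hqzy : [0, q, z, y] ∈ chains 0 y) (hp : 0 :: p :: t ∈ chains 0 y) : False := by
  obtain ⟨c, hc, hi⟩ := exists_increasing h [0, q] q y hqy hr
  obtain rfl := hy c hc
  exact not_increasing_tail_of_lt h hpq hp hqzy (label_lt_of_lt h hqs hq hs hz) hi

/-- Let the label of `p` be below the label of `q`, and let `0, q, zs` be increasing. If every coatom
`y` above `z'` is above `p` and every maximal chain of `[q, y]` passes through `z'` or `zs`, then
the increasing maximal chain of `[q, 13]` passes through `z'`. -/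
theorem false_of_increasing (h : IsCLLabeling lab) {p q z zs : Q} (z' : Q) (c : List Q)
    (hpq : lab [0] 0 p < lab [0] 0 q) (hqz : lab [0] 0 q < lab [0, q] q zs)
    (hc : q :: z :: c ∈ chains q 13) (hi : Increasing lab [0, q] (q :: z :: c)) (hzz : z ≠ z')
    (hr : [0, q] ∈ chains 0 q) (hr' : [0, q, z'] ∈ chains 0 z')
    (hz' : ∀ d ∈ chains z' 13, ∃ y, d = [z', y, 13] ∧ q ≤ y ∧ [q, z', y, 13] ∈ chains q 13 ∧
      (∀ e ∈ chains q y, e = [q, z', y] ∨ e = [q, zs, y] ∧ 0 :: e ∈ chains 0 y) ∧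
      ∃ t ∈ chains p y, 0 :: p :: t.tail ∈ chains 0 y) : False := by
  obtain ⟨d, hd, hdi⟩ := exists_increasing h [0, q, z'] z' 13 (le_top : z' ≤ ⊤) hr'
  obtain ⟨y, rfl, hqy, hy, he, t, -, ht⟩ := hz' d hd
  obtain ⟨e, hee, hei⟩ := exists_increasing h [0, q] q y hqy hr
  rcases he e hee with rfl | ⟨rfl, he0⟩
  · have := increasing_unique h (le_top : q ≤ ⊤) hr hc hy hi
      (increasing_cons.2 ⟨(increasing_cons.1 hei).1, hdi⟩)
    simp only [List.cons.injEq] at this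
    exact hzz this.2.1
  · exact not_increasing_tail_of_lt h hpq ht he0 hqz hei

theorem false_of_one_two_three (h : IsCLLabeling lab) (h12 : lab [0] 0 1 < lab [0] 0 2)
    (h23 : lab [0] 0 2 < lab [0] 0 3) : False := by
  have h28 : lab [0] 0 2 < lab [0, 2] 2 8 :=
    label_lt_of_lt h h23 (by decide) (by decide) (by decide)
  obtain ⟨c, hc, hi⟩ := exists_increasing h [0, 2] 2 13 (by decide) (by decide)
  have : ∀ c ∈ chains 2 13, c = 2 :: 4 :: c.drop 2 ∨ c = 2 :: 5 :: c.drop 2 ∨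
      c = 2 :: 8 :: c.drop 2 ∧ 0 :: c ∈ chains 0 13 := by decide +kernel
  rcases this c hc with h4 | h5 | ⟨h8, h0⟩
  · rw [h4] at hc hi
    exact false_of_increasing h 5 _ h12 h28 hc hi (by decide) (by decide) (by decide)
      (by decide +kernel)
  · rw [h5] at hc hi
    exact false_of_increasing h 4 _ h12 h28 hc hi (by decide) (by decide) (by decide)
      (by decide +kernel)
  · rw [h8] at h0 hi
    exact not_increasing_tail_of_lt (t' := [4, 10, 13]) h h12 (by decide +kernel) h0 h28 hi

theorem false_of_two_one_three (h : IsCLLabeling lab) (h21 : lab [0] 0 2 < lab [0] 0 1)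
    (h13 : lab [0] 0 1 < lab [0] 0 3) : False := by
  have h16 : lab [0] 0 1 < lab [0, 1] 1 6 :=
    label_lt_of_lt h h13 (by decide) (by decide) (by decide)
  obtain ⟨c, hc, hi⟩ := exists_increasing h [0, 1] 1 13 (by decide) (by decide)
  have : ∀ c ∈ chains 1 13, c = 1 :: 4 :: c.drop 2 ∨ c = 1 :: 5 :: c.drop 2 ∨
      c = 1 :: 6 :: c.drop 2 ∧ 0 :: c ∈ chains 0 13 := by decide +kernel
  rcases this c hc with h4 | h5 | ⟨h6, h0⟩
  · rw [h4] at hc hi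
    exact false_of_increasing h 5 _ h21 h16 hc hi (by decide) (by decide) (by decide)
      (by decide +kernel)
  · rw [h5] at hc hi
    exact false_of_increasing h 4 _ h21 h16 hc hi (by decide) (by decide) (by decide)
      (by decide +kernel)
  · rw [h6] at h0 hi
    exact not_increasing_tail_of_lt (t' := [4, 10, 13]) h h21 (by decide +kernel) h0 h16 hi

theorem not_isCLLabeling : ¬ IsCLLabeling lab := by
  intro h
  have h12 := label_lt_or_lt h (a := 1) (b := 2) (z := 4) (by decide) (by decide) (by decide)
    (by decide)
  have h13 := label_lt_or_lt h (a := 1) (b := 3) (z := 6) (by decide) (by decide) (by decide)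
    (by decide)
  have h23 := label_lt_or_lt h (a := 2) (b := 3) (z := 8) (by decide) (by decide) (by decide)
    (by decide)
  rcases h12 with h12 | h21 <;> rcases h13 with h13 | h31 <;> rcases h23 with h23 | h32
  · exact false_of_one_two_three h h12 h23
  · exact false_of_unique_chain h 8 12 [5, 12] h13 h32 (by decide) (by decide) (by decide)
      (by decide) (by decide) (by decide) (by decide) (by decide)
  · exact lt_asymm (h12.trans h23) h31
  · exact false_of_unique_chain h 5 12 [8, 12] h31 h12 (by decide) (by decide) (by decide)
      (by decide) (by decide) (by decide) (by decide) (by decide)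
  · exact false_of_two_one_three h h21 h13
  · exact lt_asymm (h21.trans h13) h32
  · exact false_of_unique_chain h 6 11 [4, 11] h23 h31 (by decide) (by decide) (by decide)
      (by decide) (by decide) (by decide) (by decide) (by decide)
  · exact false_of_unique_chain h 4 11 [6, 11] h32 h21 (by decide) (by decide) (by decide)
      (by decide) (by decide) (by decide) (by decide) (by decide)

end CL

end CCNotCL

/-- There exists a finite bounded graded poset that is CC-shellable but not
CL-shellable. -/
theorem stmt0 :
    ∃ (P : Type) (_ : PartialOrder P) (_ : BoundedOrder P) (_ : Fintype P),
      Graded P ∧ CCShellable P ∧ ¬ CLShellable P := by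
  exact ⟨CCNotCL.Q, inferInstance, inferInstance, inferInstance, CCNotCL.graded,
    CCNotCL.ccShellable, fun ⟨_, _, _, h⟩ => CCNotCL.not_isCLLabeling h⟩
end

section
/- If a finite bounded poset P admits an LCRFAS Ω, then P admits a CE-labeling λ that is compatible with Ω. -/
open scoped Classical

variable {P : Type*} [PartialOrder P] [BoundedOrder P]

theorem coverList_iff_isChain (l : List P) : CoverList l ↔ l.IsChain (· ⋖ ·) := by
  induction l with
  | nil => simp [CoverList]
  | cons x t ih =>
    cases t with
    | nil => simp [CoverList]
    | cons y t => simp [CoverList, ih]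

theorem CoverList.pairwise_lt {l : List P} (h : CoverList l) : l.Pairwise (· < ·) :=
  (((coverList_iff_isChain l).1 h).imp fun _ _ hab => hab.lt).pairwise

theorem SatFromTo.exists_eq_cons {l : List P} {x y : P} (h : SatFromTo l x y) :
    ∃ t, l = x :: t := by
  obtain ⟨h0, h1, -, -⟩ := h
  cases l with
  | nil => exact absurd rfl h0
  | cons a t => exact ⟨t, by simp_all⟩

theorem satFromTo_singleton (x : P) : SatFromTo [x] x x := by
  simp [SatFromTo, CoverList]

theorem SatFromTo.cons {l : List P} {x a y : P} (hxa : x ⋖ a) (h : SatFromTo l a y) :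
    SatFromTo (x :: l) x y := by
  obtain ⟨t, rfl⟩ := h.exists_eq_cons
  obtain ⟨-, -, h2, h3⟩ := h
  exact ⟨by simp, by simp, by simpa using h2, hxa, h3⟩

theorem SatFromTo.of_cons_cons {x' x a y : P} {t : List P} (h : SatFromTo (x' :: a :: t) x y) :
    x ⋖ a ∧ SatFromTo (a :: t) a y := by
  obtain ⟨-, h1, h2, h3⟩ := h
  obtain rfl : x' = x := by simpa using h1
  exact ⟨h3.1, by simp, by simp, by simpa using h2, h3.2⟩

theorem SatFromTo.append {l l' : List P} {x y z : P} (h : SatFromTo l x y)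
    (h' : SatFromTo l' y z) : SatFromTo (l ++ l'.tail) x z := by
  induction l generalizing x with
  | nil => exact absurd rfl h.1
  | cons u l ih =>
    obtain rfl : u = x := by simpa using h.2.1
    cases l with
    | nil =>
      obtain rfl : u = y := by simpa using h.2.2.1
      obtain ⟨t, rfl⟩ := h'.exists_eq_cons
      simpa using h'
    | cons v l =>
      obtain ⟨h1, h2⟩ := h.of_cons_cons
      exact (ih h2).cons h1

theorem SatFromTo.le {l : List P} {x y : P} (h : SatFromTo l x y) : x ≤ y := by
  induction l generalizing x with
  | nil => exact absurd rfl h.1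
  | cons u l ih =>
    cases l with
    | nil =>
      have h1 := h.2.1
      have h2 := h.2.2.1
      simp at h1 h2
      exact (h1.symm.trans h2).le
    | cons v l =>
      obtain ⟨h1, h2⟩ := h.of_cons_cons
      exact h1.le.trans (ih h2)

theorem RootOf.snoc {r : List P} {x a : P} (h : RootOf r x) (hxa : x ⋖ a) :
    RootOf (r ++ [a]) a :=
  SatFromTo.append h ((satFromTo_singleton a).cons hxa)

theorem RootOf.append_tail {r c : List P} {x y : P} (h : RootOf r x) (hc : SatFromTo c x y) :
    RootOf (r ++ c.tail) y :=
  SatFromTo.append h hc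

theorem SatFromTo.getLast_mem {l : List P} {x y : P} (h : SatFromTo l x y) : y ∈ l :=
  List.mem_of_getLast? h.2.2.1

theorem SatFromTo.head_mem {l : List P} {x y : P} (h : SatFromTo l x y) : x ∈ l := by
  obtain ⟨t, rfl⟩ := h.exists_eq_cons
  simp

/-- A saturated chain contains at most one cover of any given element. -/
theorem CoverList.cover_unique {l : List P} (h : CoverList l) {x a b : P} (ha : a ∈ l)
    (hb : b ∈ l) (hxa : x ⋖ a) (hxb : x ⋖ b) : a = b := by
  by_contra hab
  have : ∀ u ∈ l, ∀ v ∈ l, u ≠ v → (u < v ∨ v < u) := by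
    intro u hu v hv huv
    have : Std.Symm fun u v : P => u < v ∨ v < u := ⟨fun _ _ => Or.symm⟩
    exact (h.pairwise_lt.imp fun {a b} (hlt : a < b) => (Or.inl hlt : a < b ∨ b < a)).forall
      hu hv huv
  rcases this a ha b hb hab with hlt | hlt
  · exact hxb.2 hxa.lt hlt
  · exact hxa.2 hxb.lt hlt

/-- Every interval has a first atom chain. -/
theorem exists_isFAC [Fintype P] {Ω : List P → P → P → P}
    (hatom : ∀ x y : P, x < y → ∀ r, RootOf r x → x ⋖ Ω r x y ∧ Ω r x y ≤ y)
    (y x : P) (hxy : x ≤ y) (r : List P) (hr : RootOf r x) :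
    ∃ c, SatFromTo c x y ∧ IsFAC Ω y r c := by
  induction x using (wellFounded_gt (α := P)).induction generalizing r with
  | _ x ih =>
  rcases hxy.eq_or_lt with rfl | hlt
  · exact ⟨[x], satFromTo_singleton x, by simp [IsFAC]⟩
  · obtain ⟨h1, h2⟩ := hatom x y hlt r hr
    obtain ⟨c, hc, hf⟩ := ih _ h1.lt h2 _ (hr.snoc h1)
    obtain ⟨t, rfl⟩ := hc.exists_eq_cons
    exact ⟨_, hc.cons h1, fun _ => rfl, hf⟩

/-- A chain without pseudo descents starts with the first atom. -/
theorem eq_firstAtom_of_not_hasPseudoDescent {Ω : List P → P → P → P}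
    (hatom : ∀ x y : P, x < y → ∀ r, RootOf r x → x ⋖ Ω r x y ∧ Ω r x y ≤ y)
    (hrec : ∀ x y : P, x < y → ∀ r, RootOf r x → ∀ a, x ⋖ a → a < y →
      a = Ω r x (Ω (r ++ [a]) a y) → a = Ω r x y)
    {x' x a y : P} {r t : List P} (hr : RootOf r x) (hc : SatFromTo (x' :: a :: t) x y)
    (hd : ¬ HasPseudoDescent Ω r (x' :: a :: t)) : a = Ω r x y := by
  induction t generalizing x' x a r with
  | nil =>
    obtain ⟨h1, h2⟩ := hc.of_cons_cons
    obtain rfl : a = y := by simpa using h2.2.2.1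
    obtain ⟨h3, h4⟩ := hatom x a h1.lt r hr
    by_contra hne
    exact h1.2 h3.lt (lt_of_le_of_ne h4 (Ne.symm hne))
  | cons z t ih =>
    obtain rfl : x' = x := by simpa using hc.2.1
    obtain ⟨h1, h2⟩ := hc.of_cons_cons
    simp only [HasPseudoDescent, not_or, not_not] at hd
    have hz := ih (hr.snoc h1) h2 hd.2
    obtain ⟨h3, h4⟩ := h2.of_cons_cons
    have hay : a < y := h3.lt.trans_le h4.le
    refine hrec _ y (h1.lt.trans hay) r hr a h1 hay ?_
    rw [← hz]
    exact hd.1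

theorem HasPseudoDescent.exists_stepRel [Fintype P] {Ω : List P → P → P → P}
    (hatom : ∀ x y : P, x < y → ∀ r, RootOf r x → x ⋖ Ω r x y ∧ Ω r x y ≤ y)
    {y : P} {d : List P} (hdt : SatFromTo d y ⊤) (c : List P) :
    ∀ {x : P} {r : List P}, RootOf r x → SatFromTo c x y → HasPseudoDescent Ω r c →
    ∃ c', SatFromTo c' x y ∧ c' ≠ c ∧
      StepRel Ω (r ++ c'.tail ++ d.tail) (r ++ c.tail ++ d.tail) := by
  induction c with
  | nil => intro x r _ _ hp; simp [HasPseudoDescent] at hp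
  | cons u c ih =>
    intro x r hr hc hp
    obtain rfl : u = x := by simpa using hc.2.1
    rcases c with _ | ⟨v, _ | ⟨w, t⟩⟩
    · simp [HasPseudoDescent] at hp
    · simp [HasPseudoDescent] at hp
    · obtain ⟨huv, hc1⟩ := hc.of_cons_cons
      obtain ⟨hvw, hc2⟩ := hc1.of_cons_cons
      by_cases hv : v = Ω r u w
      · have hp' : HasPseudoDescent Ω (r ++ [v]) (v :: w :: t) := by
          rcases hp with hp | hp
          · exact absurd hv hp
          · exact hp
        obtain ⟨c', h1, h2, h3⟩ := ih (hr.snoc huv) hc1 hp'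
        obtain ⟨t', rfl⟩ := h1.exists_eq_cons
        exact ⟨u :: v :: t', h1.cons huv, by simpa using h2, by simpa using h3⟩
      · obtain ⟨e, he, hf⟩ := exists_isFAC hatom w u (huv.lt.trans hvw.lt).le r hr
        have hs : SatFromTo (e ++ t) u y := he.append hc2
        refine ⟨e ++ t, hs, ?_, ?_⟩
        · intro heq
          have : e = [u, v, w] :=
            List.append_cancel_right (bs := t) (by simpa using heq)
          subst this
          exact hv (hf.1 (by simp))
        · refine ⟨SatFromTo.append (hr.append_tail hs) hdt,
            SatFromTo.append (hr.append_tail hc) hdt,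
            u, v, w, r, t ++ d.tail, e, hr, huv, hvw, hv, by simp, he, hf, ?_⟩
          obtain ⟨t', rfl⟩ := he.exists_eq_cons
          simp

/-- For every maximal chain `c` of a rooted interval there is one without pseudo descents which
occurs in `Γ` no later than `c`. -/
theorem exists_earlier_not_hasPseudoDescent [Fintype P] {Ω : List P → P → P → P} {Γ : List (List P)}
    (hΓ : LinExtOf Ω Γ)
    (hatom : ∀ x y : P, x < y → ∀ r, RootOf r x → x ⋖ Ω r x y ∧ Ω r x y ≤ y)
    {x y : P} {r c : List P} (hr : RootOf r x) (hc : SatFromTo c x y) :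
    ∃ i j c', SatFromTo c' x y ∧ ¬ HasPseudoDescent Ω r c' ∧ i ≤ j ∧ j < Γ.length ∧
      (∀ w ∈ r ++ c'.tail, w ∈ Γ.getD i []) ∧ (∀ w ∈ r ++ c.tail, w ∈ Γ.getD j []) := by
  obtain ⟨d, hd, -⟩ := exists_isFAC hatom ⊤ y le_top _ (hr.append_tail hc)
  have key : ∀ c, SatFromTo c x y →
      ∃ i, i < Γ.length ∧ Γ.getD i [] = r ++ c.tail ++ d.tail := by
    intro c hc
    have hm : r ++ c.tail ++ d.tail ∈ Γ :=
      (hΓ.1.2 _).2 (SatFromTo.append (hr.append_tail hc) hd)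
    obtain ⟨i, hi, hi'⟩ := List.mem_iff_getElem.1 hm
    exact ⟨i, hi, by simp [hi, hi']⟩
  obtain ⟨j, hj, hj'⟩ := key c hc
  have hex : ∃ i, i < Γ.length ∧ ∃ c, SatFromTo c x y ∧
      Γ.getD i [] = r ++ c.tail ++ d.tail := ⟨j, hj, c, hc, hj'⟩
  obtain ⟨hi, c', hc', hi'⟩ := Nat.find_spec hex
  refine ⟨Nat.find hex, j, c', hc', ?_, Nat.find_min' hex ⟨hj, c, hc, hj'⟩, hj, ?_, ?_⟩
  · intro hp
    obtain ⟨c'', hc'', hne, hstep⟩ := hp.exists_stepRel hatom hd c' hr hc'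
    obtain ⟨k, hk, hk'⟩ := key c'' hc''
    have h1 : k ≤ Nat.find hex := by
      refine hΓ.2 k _ hk hi (Relation.ReflTransGen.single ?_)
      rw [hk', hi']
      exact hstep
    have h2 : Nat.find hex ≤ k := Nat.find_min' hex ⟨hk, c'', hc'', hk'⟩
    rw [le_antisymm h1 h2, hi'] at hk'
    obtain ⟨t', rfl⟩ := hc'.exists_eq_cons
    obtain ⟨t'', rfl⟩ := hc''.exists_eq_cons
    simp at hk'
    exact hne (by rw [hk'])
  · intro w hw
    rw [hi']
    exact List.mem_append_left _ hw
  · intro w hw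
    rw [hj']
    exact List.mem_append_left _ hw

/-- `n` bounds the positions of the chains through `r ∪ {a}`, and no atom above the root `r`
of `x` has chains through it on both sides of the cut at `n`. -/
def IsCut (Γ : List (List P)) (r : List P) (x a : P) (n : ℕ) : Prop :=
  (∀ b, x ⋖ b → ∀ i ≤ n, (∀ w ∈ r ++ [b], w ∈ Γ.getD i []) →
    ∀ k, (∀ w ∈ r ++ [b], w ∈ Γ.getD k []) → k ≤ n) ∧
  ∀ k, (∀ w ∈ r ++ [a], w ∈ Γ.getD k []) → k ≤ n

/-- The labeling by the least cut lying above all chains through the labeled cover relation. -/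
noncomputable def cutLabel (Γ : List (List P)) (r : List P) (x a : P) : ℕ :=
  sInf {n | IsCut Γ r x a n}

theorem lt_length_of_mem_getD {Γ : List (List P)} {k : ℕ} {w : P} (h : w ∈ Γ.getD k []) :
    k < Γ.length := by
  by_contra hk
  rw [List.getD_eq_default _ _ (not_lt.1 hk)] at h
  exact List.not_mem_nil h

theorem isCut_cutLabel (Γ : List (List P)) (r : List P) (x a : P) :
    IsCut Γ r x a (cutLabel Γ r x a) := by
  have hne : {n | IsCut Γ r x a n}.Nonempty :=
    ⟨Γ.length, fun b _ _ _ _ k hk => (lt_length_of_mem_getD (hk b (by simp))).le,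
      fun k hk => (lt_length_of_mem_getD (hk a (by simp))).le⟩
  exact Nat.sInf_mem hne

theorem cutLabel_le_cutLabel {Γ : List (List P)} {r : List P} {x a b : P} (hxa : x ⋖ a)
    {i j : ℕ} (hij : i ≤ j) (hi : ∀ w ∈ r ++ [a], w ∈ Γ.getD i [])
    (hj : ∀ w ∈ r ++ [b], w ∈ Γ.getD j []) : cutLabel Γ r x a ≤ cutLabel Γ r x b := by
  have h := isCut_cutLabel Γ r x b
  exact Nat.sInf_le ⟨h.1, h.1 a hxa i (hij.trans (h.2 j hj)) hi⟩

theorem cutLabel_lt_cutLabel {Γ : List (List P)} (hΓ : Enumerates Γ) (hLC : LCCondition Γ)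
    {r : List P} {x a b a' b' : P} (hr : RootOf r x) (hxa : x ⋖ a) (hab : a ⋖ b)
    (hxa' : x ⋖ a') (hne : a' ≠ a) {i j : ℕ} (hij : i ≤ j)
    (hi : ∀ w ∈ r ++ [a] ++ [b], w ∈ Γ.getD i [])
    (hj : ∀ w ∈ r ++ [a'] ++ [b'], w ∈ Γ.getD j []) :
    cutLabel Γ (r ++ [a]) a b < cutLabel Γ (r ++ [a']) a' b' := by
  have hjl : j < Γ.length := lt_length_of_mem_getD (hj a' (by simp))
  have hj' : ∀ w ∈ r ++ [a'], w ∈ Γ.getD j [] := fun w hw => hj w (List.mem_append_left _ hw)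
  have hcov : CoverList (Γ.getD j []) := by
    refine ((hΓ.2 _).1 ?_).2.2.2
    rw [List.getD_eq_getElem _ _ hjl]
    exact List.getElem_mem hjl
  have hnej : ∀ z k, (∀ w ∈ r ++ [a] ++ [z], w ∈ Γ.getD k []) → k ≠ j := by
    rintro z k hk rfl
    exact hne (hcov.cover_unique (hj a' (by simp)) (hk a (by simp)) hxa' hxa)
  have hblock : ∀ z, a ⋖ z → ∀ i < j, (∀ w ∈ r ++ [a] ++ [z], w ∈ Γ.getD i []) →
      ∀ k, (∀ w ∈ r ++ [a] ++ [z], w ∈ Γ.getD k []) → k < j := by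
    intro z haz i hij hi k hk
    by_contra hkj
    have hjk : j < k := lt_of_le_of_ne (not_lt.1 hkj) (hnej z k hk).symm
    exact hne (hLC i j k hij hjk (lt_length_of_mem_getD (hk a (by simp))) r x a a' z hr hxa haz
      hxa' (by simpa using hi) (by simpa using hk) hj')
  have hij' : i < j := lt_of_le_of_ne hij (hnej b i hi)
  have hle : cutLabel Γ (r ++ [a]) a b ≤ j - 1 :=
    Nat.sInf_le ⟨fun z haz i hij hi k hk => by
        have := hblock z haz i (by omega) hi k hk
        omega,
      fun k hk => by
        have := hblock b hab i hij' hi k hk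
        omega⟩
  have hge : j ≤ cutLabel Γ (r ++ [a']) a' b' := (isCut_cutLabel Γ _ a' b').2 j hj
  omega

/-- A nonempty interval of a finite poset has a maximal chain with lexicographically smallest
label sequence. -/
theorem exists_lex_min_chain [Fintype P] (lab : List P → P → P → ℤ) (r : List P) {x y : P}
    (hne : ∃ c, SatFromTo c x y) :
    ∃ c, SatFromTo c x y ∧ ∀ c', SatFromTo c' x y →
      ¬ List.Lex (· < ·) (labelSeq lab r c') (labelSeq lab r c) := by
  have hfin : {c : List P | SatFromTo c x y}.Finite := by
    refine (List.finite_length_le P (Fintype.card P)).subset fun c hc => ?_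
    exact List.Nodup.length_le_card (hc.2.2.2.pairwise_lt.imp fun h => h.ne)
  obtain ⟨c, hc, hmin⟩ := Set.exists_min_image _ (labelSeq lab r) hfin hne
  exact ⟨c, hc, fun c' hc' hlt => not_lt_of_ge (hmin c' hc') hlt⟩

/-- Lemma 6.4: if a finite bounded poset admits an LCRFAS `Ω`, then it admits a
CE-labeling compatible with `Ω`. -/
theorem stmt17 {P : Type*} [PartialOrder P] [BoundedOrder P] [Fintype P]
    (Ω : List P → P → P → P) (h : IsLCRFAS Ω) :
    ∃ lab : List P → P → P → ℤ, Compatible lab Ω := by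
  obtain ⟨hΩ | hΩ, Γ, hΓ, hLC⟩ := h
  · have hbt : ∀ p : P, p = ⊥ ∨ p = ⊤ := by
      intro p
      by_contra! hp
      obtain ⟨a, -, ha⟩ := exists_le_covBy_of_lt (bot_lt_iff_ne_bot.2 hp.1)
      obtain ⟨b, hb, -⟩ := exists_covBy_le_of_lt (lt_top_iff_ne_top.2 hp.2)
      have := hΩ [a, p, b] ⟨ha, hb, trivial⟩
      simp at this
    refine ⟨fun _ _ _ => 0, fun x y hxy r _ => ?_⟩
    obtain rfl : x = ⊥ := (hbt x).resolve_right (by rintro rfl; exact not_top_lt hxy)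
    obtain rfl : y = ⊤ := (hbt y).resolve_left (by rintro rfl; exact lt_irrefl _ hxy)
    have hcov : (⊥ : P) ⋖ ⊤ := ⟨hxy, fun z h1 h2 => by
      rcases hbt z with rfl | rfl
      · exact lt_irrefl _ h1
      · exact lt_irrefl _ h2⟩
    obtain ⟨c, hc, hmin⟩ := exists_lex_min_chain (fun _ _ _ => 0) r
      ⟨_, (satFromTo_singleton (⊤ : P)).cons hcov⟩
    refine ⟨c, hc, ?_, hmin⟩
    rcases hbt (Ω r ⊥ ⊤) with h | h <;> rw [h]
    · exact hc.head_mem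
    · exact hc.getLast_mem
  · have hatom : ∀ x y : P, x < y → ∀ r, RootOf r x → x ⋖ Ω r x y ∧ Ω r x y ≤ y :=
      fun x y hxy r hr => (hΩ x y hxy r hr).1
    have hrec : ∀ x y : P, x < y → ∀ r, RootOf r x → ∀ a, x ⋖ a → a < y →
        a = Ω r x (Ω (r ++ [a]) a y) → a = Ω r x y :=
      fun x y hxy r hr a h1 h2 => ((hΩ x y hxy r hr).2 a h1 h2).1.2
    refine ⟨fun r x a => (cutLabel Γ r x a : ℤ), fun x y hxy r hr => ?_⟩
    obtain ⟨e, he, -⟩ := exists_isFAC hatom y x hxy.le r hr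
    obtain ⟨c, hc, hmin⟩ := exists_lex_min_chain (fun r x a => (cutLabel Γ r x a : ℤ)) r ⟨e, he⟩
    refine ⟨c, hc, ?_, hmin⟩
    by_contra hmem
    obtain ⟨i, j, c', hc', hp, hij, -, hi, hj⟩ :=
      exists_earlier_not_hasPseudoDescent hΓ hatom hr hc
    obtain ⟨t, rfl⟩ := hc.exists_eq_cons
    obtain ⟨t', rfl⟩ := hc'.exists_eq_cons
    match t, t', hc, hc' with
    | [], _, hc, _ => exact hxy.ne (by simpa using hc.2.2.1)
    | _, [], _, hc' => exact hxy.ne (by simpa using hc'.2.2.1)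
    | a' :: s, a :: s', hc, hc' =>
      obtain ⟨hxa', hs⟩ := hc.of_cons_cons
      obtain ⟨hxa, hs'⟩ := hc'.of_cons_cons
      have ha : a = Ω r x y := eq_firstAtom_of_not_hasPseudoDescent hatom hrec hr hc' hp
      rw [← ha] at hmem
      have hne : a' ≠ a := by rintro rfl; simp at hmem
      match s, s', hs, hs' with
      | [], _, hs, hs' =>
        obtain rfl : a' = y := by simpa using hs.2.2.1
        exact hxa'.2 hxa.lt (lt_of_le_of_ne hs'.le hne.symm)
      | _, [], hs, hs' =>
        obtain rfl : a = y := by simpa using hs'.2.2.1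
        exact hxa.2 hxa'.lt (lt_of_le_of_ne hs.le hne)
      | b' :: s, b :: s', hs, hs' =>
        obtain ⟨hab, -⟩ := hs'.of_cons_cons
        have hle : cutLabel Γ r x a ≤ cutLabel Γ r x a' :=
          cutLabel_le_cutLabel hxa hij (fun w hw => hi w (by simp at hw ⊢; tauto))
            (fun w hw => hj w (by simp at hw ⊢; tauto))
        have hlt : cutLabel Γ (r ++ [a]) a b < cutLabel Γ (r ++ [a']) a' b' :=
          cutLabel_lt_cutLabel hΓ.1 hLC hr hxa hab hxa' hne hij
            (fun w hw => hi w (by simp at hw ⊢; tauto))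
            (fun w hw => hj w (by simp at hw ⊢; tauto))
        refine hmin _ hc' ?_
        simp only [labelSeq]
        rcases hle.lt_or_eq with h | h
        · exact List.Lex.rel (by exact_mod_cast h)
        · rw [h]
          exact List.Lex.cons (List.Lex.rel (by exact_mod_cast hlt))
end
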